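/- arXiv:1805.07086 — 4 statements merged into one kernel-verified Lean document; each statement's English description precedes it below -/
import Mathlib

section
/- Fix x, y > 0. The function β ↦ d_β(x,y) = (x^β + (β−1)y^β − β·x·y^{β−1})/(β(β−1)), defined on ℝ \ {0,1}, tends to x(log x − log y) + (y − x) as β → 1. -/
open Real Filter

/-- For fixed `x, y > 0`, the map `β ↦ d_β(x,y) = (x^β + (β-1)y^β - β x y^{β-1})/(β(β-1))`,
defined on `ℝ \ {0,1}`, tends to the Kullback–Leibler divergence
`x(log x - log y) + (y - x)` as `β → 1`. -/
theorem tendsto_betaDiv_at_one (x y : ℝ) (hx : 0 < x) (hy : 0 < y) :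
    Tendsto (fun β : ℝ => (x ^ β + (β - 1) * y ^ β - β * x * y ^ (β - 1)) / (β * (β - 1)))
      (nhdsWithin 1 ({0, 1} : Set ℝ)ᶜ)
      (nhds (x * (Real.log x - Real.log y) + (y - x))) := by
  have h1 : HasDerivAt (fun β : ℝ => x ^ β) (x ^ (1:ℝ) * Real.log x) 1 := by
    simpa [mul_comm] using (hasDerivAt_id (1:ℝ)).const_rpow (a := x) hx
  have h2 : HasDerivAt (fun β : ℝ => y ^ β) (y ^ (1:ℝ) * Real.log y) 1 := by
    simpa [mul_comm] using (hasDerivAt_id (1:ℝ)).const_rpow (a := y) hy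
  have h4 : HasDerivAt (fun β : ℝ => β - 1) 1 1 := (hasDerivAt_id (1:ℝ)).sub_const 1
  have h3 : HasDerivAt (fun β : ℝ => y ^ (β - 1)) (Real.log y) 1 := by
    simpa using h4.const_rpow (a := y) hy
  have h5 : HasDerivAt (fun β : ℝ => β * x) x 1 := by
    simpa using (hasDerivAt_id (1:ℝ)).mul_const x
  have hN : HasDerivAt (fun β : ℝ => x ^ β + (β - 1) * y ^ β - β * x * y ^ (β - 1))
      (x * (Real.log x - Real.log y) + (y - x)) 1 := by
    have h := (h1.add (h4.mul h2)).sub (h5.mul h3)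
    refine h.congr_deriv ?_
    simp only [Real.rpow_one, sub_self, Real.rpow_zero]
    ring
  have hs := hN.tendsto_slope
  have hsub : ({0, 1} : Set ℝ)ᶜ ⊆ {1}ᶜ := by
    intro b hb
    simp_all
  have hs' := hs.mono_left (nhdsWithin_mono 1 hsub)
  have hi : Tendsto (fun β : ℝ => β⁻¹) (nhdsWithin 1 ({0, 1} : Set ℝ)ᶜ) (nhds 1) := by
    have : Tendsto (fun β : ℝ => β⁻¹) (nhds 1) (nhds (1:ℝ)⁻¹) := tendsto_inv₀ one_ne_zero
    rw [inv_one] at this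
    exact this.mono_left nhdsWithin_le_nhds
  have hm := hs'.mul hi
  rw [mul_one] at hm
  refine hm.congr fun β => ?_
  rw [slope_def_field]
  simp only [Real.rpow_one, sub_self, Real.rpow_zero, zero_mul, one_mul, mul_one, add_zero, sub_zero]
  rw [div_eq_mul_inv, div_eq_mul_inv, mul_inv]
  ring
end

section
/- Fix x, y > 0. The function β ↦ d_β(x,y) = (x^β + (β−1)y^β − β·x·y^{β−1})/(β(β−1)), defined on ℝ \ {0,1}, tends to x/y − log(x/y) − 1 as β → 0. -/
open Real Filter

/-- For fixed `x, y > 0`, the map `β ↦ d_β(x,y) = (x^β + (β-1)y^β - β x y^{β-1})/(β(β-1))`,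
defined on `ℝ \ {0,1}`, tends to the Itakura–Saito divergence
`x/y - log(x/y) - 1` as `β → 0`. -/
theorem tendsto_betaDiv_at_zero (x y : ℝ) (hx : 0 < x) (hy : 0 < y) :
    Tendsto (fun β : ℝ => (x ^ β + (β - 1) * y ^ β - β * x * y ^ (β - 1)) / (β * (β - 1)))
      (nhdsWithin 0 ({0, 1} : Set ℝ)ᶜ)
      (nhds (x / y - Real.log (x / y) - 1)) := by
  have hX : HasDerivAt (fun β : ℝ => x ^ β) (Real.log x) 0 := by
    simpa using (Real.hasStrictDerivAt_const_rpow hx 0).hasDerivAt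
  have hY : HasDerivAt (fun β : ℝ => y ^ β) (Real.log y) 0 := by
    simpa using (Real.hasStrictDerivAt_const_rpow hy 0).hasDerivAt
  have hN : HasDerivAt (fun β : ℝ => x ^ β + (β - 1) * y ^ β - β * x * (y ^ β / y))
      (Real.log x + 1 - Real.log y - x / y) 0 := by
    have h := (hX.add (((hasDerivAt_id (0 : ℝ)).sub_const 1).mul hY)).sub
      (((hasDerivAt_id (0 : ℝ)).mul_const x).mul (hY.div_const y))
    refine h.congr_deriv ?_
    simp
    ring
  have hS := (hasDerivAt_iff_tendsto_slope.1 hN).mono_left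
    (nhdsWithin_mono (0 : ℝ) (s := ({0, 1} : Set ℝ)ᶜ) (t := ({0} : Set ℝ)ᶜ)
      (by intro b hb; simp at hb ⊢; exact hb.1))
  have hD : Tendsto (fun β : ℝ => β - 1) (nhdsWithin 0 ({0, 1} : Set ℝ)ᶜ) (nhds (0 - 1)) :=
    ((continuous_id.sub continuous_const).tendsto (0 : ℝ)).mono_left nhdsWithin_le_nhds
  have hQ := hS.div hD (by norm_num)
  have e : (Real.log x + 1 - Real.log y - x / y) / (0 - 1) = x / y - Real.log (x / y) - 1 := by
    rw [Real.log_div hx.ne' hy.ne']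
    ring
  rw [e] at hQ
  refine hQ.congr fun b => ?_
  simp only [Pi.div_apply, slope_def_field, Real.rpow_sub_one hy.ne', Real.rpow_zero]
  rw [← div_div]
  congr 1
  ring
end

section
/- If β ∈ [1,2], then for every fixed x > 0 the function y ↦ d_β(x,y) is convex on (0,∞). -/
open Real

/-- The β-divergence on `(0,∞)`: for `β ∉ {0,1}`,
`d_β(x,y) = (x^β + (β-1)y^β - β x y^{β-1})/(β(β-1))`;
`d_1(x,y) = x(log x - log y) + (y - x)`; `d_0(x,y) = x/y - log(x/y) - 1`. -/
noncomputable def betaDiv (β x y : ℝ) : ℝ :=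
  if β = 0 then x / y - Real.log (x / y) - 1
  else if β = 1 then x * (Real.log x - Real.log y) + (y - x)
  else (x ^ β + (β - 1) * y ^ β - β * x * y ^ (β - 1)) / (β * (β - 1))

/-- If `β ∈ [1,2]`, then for every fixed `x > 0` the map `y ↦ d_β(x,y)` is convex
on `(0,∞)`. -/
theorem betaDiv_convexOn (β : ℝ) (hβ : β ∈ Set.Icc (1 : ℝ) 2) (x : ℝ) (hx : 0 < x) :
    ConvexOn ℝ (Set.Ioi (0 : ℝ)) (fun y : ℝ => betaDiv β x y) := by
  obtain ⟨h1, h2⟩ := hβ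
  have h0 : β ≠ 0 := by linarith
  refine ⟨convex_Ioi 0, ?_⟩
  intro u hu v hv a b ha hb hab
  by_cases hb1 : β = 1
  · have h := strictConcaveOn_log_Ioi.concaveOn.2 hu hv ha hb hab
    simp only [betaDiv, h0, hb1, if_true, if_false, one_ne_zero, smul_eq_mul] at h ⊢
    have h' := mul_le_mul_of_nonneg_left h hx.le
    obtain rfl : b = 1 - a := by linarith
    linarith
  · have hlt : 1 < β := lt_of_le_of_ne h1 (Ne.symm hb1)
    have hp := (convexOn_rpow h1).2 (Set.Ioi_subset_Ici_self hu) (Set.Ioi_subset_Ici_self hv) ha hb hab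
    have hq := (Real.concaveOn_rpow (p := β - 1) (by linarith) (by linarith)).2
      (Set.Ioi_subset_Ici_self hu) (Set.Ioi_subset_Ici_self hv) ha hb hab
    simp only [betaDiv, h0, hb1, if_false, smul_eq_mul] at hp hq ⊢
    have hd : 0 < β * (β - 1) := mul_pos (by linarith) (by linarith)
    rw [← mul_div_assoc, ← mul_div_assoc, ← add_div]
    apply div_le_div_of_nonneg_right _ hd.le
    have hp' := mul_le_mul_of_nonneg_left hp (by linarith : 0 ≤ β - 1)
    have hq' := mul_le_mul_of_nonneg_left hq (by positivity : 0 ≤ β * x)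
    obtain rfl : b = 1 - a := by linarith
    linarith
end

section
/- The Itakura–Saito divergence is the only scale-invariant member of the β-divergence family: d_0(λx, λy) = d_0(x,y) for all x, y, λ > 0; and conversely, if β ∈ ℝ is such that d_β(λx, λy) = d_β(x,y) for all λ > 0 and some fixed x, y > 0 with x ≠ y, then β = 0. -/
open Real

theorem bern_neg {p t : ℝ} (ht : 0 < t) (h1 : t ≠ 1) (hp : p < 0) :
    1 + p * (t - 1) < t ^ p := by
  have h := one_add_mul_self_lt_rpow_one_add (s := t⁻¹ - 1) (p := 1 - p)
    (by have := inv_pos.mpr ht; linarith)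
    (by intro h; apply h1; have : t⁻¹ = 1 := by linarith
        simpa using this) (by linarith)
  have e : (1 + (t⁻¹ - 1)) ^ (1 - p) = t⁻¹ * t ^ p := by
    rw [show 1 + (t⁻¹ - 1) = t⁻¹ by ring, Real.rpow_sub (inv_pos.mpr ht), Real.rpow_one,
      Real.inv_rpow ht.le]
    simp [div_eq_mul_inv]
  rw [e] at h
  have h2 := mul_lt_mul_of_pos_left h ht
  have e1 : t * (t⁻¹ * t ^ p) = t ^ p := by field_simp
  have e2 : t * (1 + (1 - p) * (t⁻¹ - 1)) = 1 + p * (t - 1) := by field_simp; ring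
  linarith

theorem bern_ne {p t : ℝ} (ht : 0 < t) (h1 : t ≠ 1) (hp0 : p ≠ 0) (hp1 : p ≠ 1) :
    t ^ p ≠ 1 + p * (t - 1) := by
  have hs : t - 1 ≠ 0 := sub_ne_zero.mpr h1
  rcases lt_or_gt_of_ne hp0 with h | h
  · exact (bern_neg ht h1 h).ne'
  rcases lt_or_gt_of_ne hp1 with h' | h'
  · have := rpow_one_add_lt_one_add_mul_self (s := t - 1) (by linarith) hs h h'
    rw [show 1 + (t - 1) = t by ring] at this
    exact this.ne
  · have := one_add_mul_self_lt_rpow_one_add (s := t - 1) (by linarith) hs h'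
    rw [show 1 + (t - 1) = t by ring] at this
    exact this.ne'

/-- The Itakura–Saito divergence is the only scale-invariant member of the β-divergence
family: `d_0` is scale invariant, and if `d_β(λx, λy) = d_β(x,y)` for all `λ > 0` and
some fixed `x, y > 0` with `x ≠ y`, then `β = 0`. -/
theorem itakuraSaito_unique_scale_invariant :
    (∀ x y lam : ℝ, 0 < x → 0 < y → 0 < lam →
      betaDiv 0 (lam * x) (lam * y) = betaDiv 0 x y) ∧
    (∀ β x y : ℝ, 0 < x → 0 < y → x ≠ y →
      (∀ lam : ℝ, 0 < lam → betaDiv β (lam * x) (lam * y) = betaDiv β x y) → β = 0) := by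
  constructor
  · intro x y lam hx hy hl
    simp only [betaDiv, if_true]
    rw [mul_div_mul_left _ _ hl.ne']
  · intro β x y hx hy hxy H
    by_contra h0
    have H2 := H 2 two_pos
    by_cases h1 : β = 1
    · simp only [betaDiv, h0, h1, if_false, if_true, one_ne_zero] at H2
      rw [Real.log_mul two_ne_zero hx.ne', Real.log_mul two_ne_zero hy.ne'] at H2
      have h := Real.log_lt_sub_one_of_pos (div_pos hy hx)
        (by intro h; exact hxy ((div_eq_one_iff_eq hx.ne').mp h).symm)
      rw [Real.log_div hy.ne' hx.ne'] at h
      have h2 := mul_lt_mul_of_pos_left h hx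
      have e : x * (y / x - 1) = y - x := by field_simp
      linarith
    · simp only [betaDiv, h0, h1, if_false] at H2
      have hd : β * (β - 1) ≠ 0 := mul_ne_zero h0 (sub_ne_zero.mpr h1)
      rw [div_left_inj' hd, Real.mul_rpow two_pos.le hx.le, Real.mul_rpow two_pos.le hy.le,
        Real.rpow_sub_one (by positivity), Real.rpow_sub_one hy.ne',
        Real.mul_rpow two_pos.le hy.le] at H2
      have e : β * (2 * x) * ((2:ℝ) ^ β * y ^ β / (2 * y))
          = (2:ℝ) ^ β * (β * x * (y ^ β / y)) := by field_simp
      rw [e] at H2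
      have hne := bern_ne (div_pos hx hy)
        (by intro h; exact hxy ((div_eq_one_iff_eq hy.ne').mp h)) h0 h1
      rw [Real.div_rpow hx.le hy.le] at hne
      have hyp : 0 < y ^ β := Real.rpow_pos_of_pos hy β
      have hD : x ^ β + (β - 1) * y ^ β - β * x * (y ^ β / y) ≠ 0 := by
        intro h
        apply hne
        rw [div_eq_iff hyp.ne']
        have e3 : (1 + β * (x / y - 1)) * y ^ β
            = y ^ β + β * x * (y ^ β / y) - β * y ^ β := by ring
        rw [e3]
        linarith
      have h3 : ((2:ℝ) ^ β - 1) * (x ^ β + (β - 1) * y ^ β - β * x * (y ^ β / y)) = 0 := by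
        linear_combination H2
      have h4 : (2:ℝ) ^ β = 1 := by
        rcases mul_eq_zero.mp h3 with h | h
        · linarith
        · exact absurd h hD
      have h5 := congrArg Real.log h4
      rw [Real.log_rpow two_pos, Real.log_one] at h5
      rcases mul_eq_zero.mp h5 with h | h
      · exact h0 h
      · exact (Real.log_pos one_lt_two).ne' h
end
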